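/- arXiv:2007.10622 — 5 statements merged into one kernel-verified Lean document; each statement's English description precedes it below -/
import Mathlib

section
/- Let n, T ≥ 2 be integers, κ = 8⌈log(nT)⌉, and let p be a mean-zero probability distribution on ℝ^n supported on the closed Euclidean unit ball whose covariance Σ = E_{v∼p}[vv^⊤] is κ-dyadic. For k ∈ {1,…,κ} let Π_k be the orthogonal projection onto the eigenspace of Σ for eigenvalue 2^{−k}, and Π = Σ_k Π_k. Let S ⊂ ℝ^n be a nonempty finite set of vectors of Euclidean norm at most 1, p_x = (1/2)p + (1/2)Unif(S), λ = 1/(100κ·log(nT)), d ∈ ℝ^n with ‖d‖_2 ≤ T, and let Φ = Σ_{k=1}^κ E_{x∼p_x}[cosh(λ⟨d,Π_k x⟩)]. Set B = κ·log(4λΦ²T) and L(v) = λ·Σ_{k=1}^κ E_{x∼p_x}[ sinh(λ⟨d,Π_k x⟩)·⟨v,Π_k x⟩ ]. Then E_{v∼p}[|L(v)|] ≥ (λ/B)·Σ_{k=1}^κ 2^{−k}·E_{x∼p_x}[ |sinh(λ⟨d,Π_k x⟩)| ] − 1. -/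
open Real MeasureTheory

noncomputable def euclNorm {n : ℕ} (x : Fin n → ℝ) : ℝ := Real.sqrt (∑ i, x i ^ 2)

noncomputable def euclDot {n : ℕ} (x y : Fin n → ℝ) : ℝ := ∑ i, x i * y i

section LinearAlgebra

open Matrix

lemma euclDot_eq_dotProduct {n : ℕ} (x y : Fin n → ℝ) : euclDot x y = x ⬝ᵥ y := rfl

lemma dotProduct_self_nonneg_real {n : ℕ} (x : Fin n → ℝ) : 0 ≤ x ⬝ᵥ x :=
  Finset.sum_nonneg fun i _ => mul_self_nonneg (x i)

lemma euclNorm_le_iff {n : ℕ} (x : Fin n → ℝ) {c : ℝ} (hc : 0 ≤ c) :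
    euclNorm x ≤ c ↔ x ⬝ᵥ x ≤ c ^ 2 := by
  rw [euclNorm, Real.sqrt_le_left hc]
  simp only [dotProduct, sq]

lemma dotProduct_sq_le {n : ℕ} (x y : Fin n → ℝ) :
    (x ⬝ᵥ y) ^ 2 ≤ (x ⬝ᵥ x) * (y ⬝ᵥ y) := by
  have := Finset.sum_mul_sq_le_sq_mul_sq Finset.univ x y
  simpa only [dotProduct, sq] using this

lemma dotProduct_sq_le_of_le {n : ℕ} {x y : Fin n → ℝ} {a b : ℝ} (hx : x ⬝ᵥ x ≤ a)
    (hy : y ⬝ᵥ y ≤ b) : (x ⬝ᵥ y) ^ 2 ≤ a * b :=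
  (dotProduct_sq_le x y).trans <| mul_le_mul hx hy (dotProduct_self_nonneg_real y)
    ((dotProduct_self_nonneg_real x).trans hx)

lemma Matrix.IsSymm.mulVec_dotProduct {n : ℕ} {M : Matrix (Fin n) (Fin n) ℝ} (hM : M.IsSymm)
    (x y : Fin n → ℝ) : M *ᵥ x ⬝ᵥ y = x ⬝ᵥ M *ᵥ y := by
  rw [dotProduct_mulVec, ← mulVec_transpose, hM.eq]

lemma mulVec_dotProduct_self_of_idem {n : ℕ} {M : Matrix (Fin n) (Fin n) ℝ} (hM : M.IsSymm)
    (hi : M * M = M) (x : Fin n → ℝ) : M *ᵥ x ⬝ᵥ M *ᵥ x = x ⬝ᵥ M *ᵥ x := by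
  rw [hM.mulVec_dotProduct, mulVec_mulVec, hi]

lemma dotProduct_mulVec_le_self_of_idem {n : ℕ} {M : Matrix (Fin n) (Fin n) ℝ} (hM : M.IsSymm)
    (hi : M * M = M) (x : Fin n → ℝ) : x ⬝ᵥ M *ᵥ x ≤ x ⬝ᵥ x := by
  have h := dotProduct_self_nonneg_real (x - M *ᵥ x)
  rw [sub_dotProduct, dotProduct_sub, dotProduct_sub, mulVec_dotProduct_self_of_idem hM hi,
    hM.mulVec_dotProduct] at h
  linarith

lemma mulVec_dotProduct_self_le {n : ℕ} {M : Matrix (Fin n) (Fin n) ℝ} (hM : M.IsSymm)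
    (hi : M * M = M) (x : Fin n → ℝ) : M *ᵥ x ⬝ᵥ M *ᵥ x ≤ x ⬝ᵥ x :=
  (mulVec_dotProduct_self_of_idem hM hi x).trans_le (dotProduct_mulVec_le_self_of_idem hM hi x)

/-- Orthogonal projections onto pairwise distinct eigenspaces of a symmetric matrix. -/
structure SpectralProjections {n κ : ℕ} (Cov : Matrix (Fin n) (Fin n) ℝ)
    (P : Fin κ → Matrix (Fin n) (Fin n) ℝ) (c : Fin κ → ℝ) : Prop where
  cov_symm : Cov.IsSymm
  symm : ∀ k, (P k).IsSymm
  idem : ∀ k, P k * P k = P k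
  inj : Function.Injective c
  cov_mulVec : ∀ k x, Cov *ᵥ (P k *ᵥ x) = c k • (P k *ᵥ x)

namespace SpectralProjections

variable {n κ : ℕ} {Cov : Matrix (Fin n) (Fin n) ℝ} {P : Fin κ → Matrix (Fin n) (Fin n) ℝ}
  {c : Fin κ → ℝ}

lemma mul_eq_zero (h : SpectralProjections Cov P c) {j k : Fin κ} (hjk : j ≠ k) :
    P j * P k = 0 := by
  have key : ∀ x y : Fin n → ℝ, y ⬝ᵥ (P j * P k) *ᵥ x = 0 := by
    intro x y
    rw [← mulVec_mulVec, ← (h.symm j).mulVec_dotProduct]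
    have e := h.cov_symm.mulVec_dotProduct (P j *ᵥ y) (P k *ᵥ x)
    rw [h.cov_mulVec, h.cov_mulVec, smul_dotProduct, dotProduct_smul, smul_eq_mul,
      smul_eq_mul] at e
    have hc : c j - c k ≠ 0 := sub_ne_zero.2 fun hc => hjk (h.inj hc)
    have : (c j - c k) * (P j *ᵥ y ⬝ᵥ P k *ᵥ x) = 0 := by linarith
    exact (_root_.mul_eq_zero.1 this).resolve_left hc
  ext a b
  simpa using key (Pi.single b 1) (Pi.single a 1)

lemma sum_mul (h : SpectralProjections Cov P c) (k : Fin κ) : (∑ j, P j) * P k = P k := by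
  rw [Finset.sum_mul, Finset.sum_eq_single k (fun j _ hj => h.mul_eq_zero hj) (by simp), h.idem]

lemma sum_symm (h : SpectralProjections Cov P c) : (∑ j, P j).IsSymm := by
  rw [Matrix.IsSymm, transpose_sum]
  exact Finset.sum_congr rfl fun j _ => (h.symm j).eq

lemma sum_idem (h : SpectralProjections Cov P c) : (∑ j, P j) * (∑ j, P j) = ∑ j, P j := by
  conv_lhs => rw [Finset.mul_sum]
  exact Finset.sum_congr rfl fun k _ => h.sum_mul k

lemma sum_dotProduct_sq_le (h : SpectralProjections Cov P c) (d x : Fin n → ℝ) :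
    ∑ k, (d ⬝ᵥ P k *ᵥ x) ^ 2 ≤ (d ⬝ᵥ d) * (x ⬝ᵥ x) := by
  have hk : ∀ k, (d ⬝ᵥ P k *ᵥ x) ^ 2 ≤ (d ⬝ᵥ P k *ᵥ d) * (x ⬝ᵥ x) := by
    intro k
    have e : d ⬝ᵥ P k *ᵥ x = P k *ᵥ d ⬝ᵥ x := ((h.symm k).mulVec_dotProduct d x).symm
    rw [e, ← mulVec_dotProduct_self_of_idem (h.symm k) (h.idem k)]
    exact dotProduct_sq_le _ _
  calc ∑ k, (d ⬝ᵥ P k *ᵥ x) ^ 2 ≤ ∑ k, (d ⬝ᵥ P k *ᵥ d) * (x ⬝ᵥ x) :=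
        Finset.sum_le_sum fun k _ => hk k
    _ = (d ⬝ᵥ (∑ k, P k) *ᵥ d) * (x ⬝ᵥ x) := by
        rw [← Finset.sum_mul, sum_mulVec, dotProduct_sum]
    _ ≤ (d ⬝ᵥ d) * (x ⬝ᵥ x) :=
        mul_le_mul_of_nonneg_right (dotProduct_mulVec_le_self_of_idem h.sum_symm h.sum_idem d)
          (dotProduct_self_nonneg_real x)

lemma abs_dotProduct_le (h : SpectralProjections Cov P c) {d x : Fin n → ℝ} {T : ℝ} (hT : 0 ≤ T)
    (hd : d ⬝ᵥ d ≤ T ^ 2) (hx : x ⬝ᵥ x ≤ 1) (k : Fin κ) : |d ⬝ᵥ P k *ᵥ x| ≤ T := by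
  refine abs_le_of_sq_le_sq ?_ hT
  simpa using dotProduct_sq_le_of_le hd
    ((mulVec_dotProduct_self_le (h.symm k) (h.idem k) x).trans hx)

end SpectralProjections

end LinearAlgebra

section Integration

open Matrix

lemma integrable_of_ae_dotProduct_self_le {n : ℕ} {μ : Measure (Fin n → ℝ)} [IsFiniteMeasure μ]
    (hμ : ∀ᵐ x ∂μ, x ⬝ᵥ x ≤ 1) {f : (Fin n → ℝ) → ℝ} (hf : Continuous f) : Integrable f μ := by
  have hK : IsCompact (Metric.closedBall (0 : Fin n → ℝ) 1) := isCompact_closedBall _ _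
  obtain ⟨C, hC⟩ := hK.exists_bound_of_continuousOn hf.continuousOn
  refine Integrable.of_bound hf.aestronglyMeasurable C ?_
  filter_upwards [hμ] with x hx
  refine hC x ?_
  rw [mem_closedBall_zero_iff, pi_norm_le_iff_of_nonneg zero_le_one]
  intro i
  have : x i * x i ≤ x ⬝ᵥ x :=
    Finset.single_le_sum (f := fun i => x i * x i) (fun j _ => mul_self_nonneg (x j))
      (Finset.mem_univ i)
  rw [Real.norm_eq_abs, abs_le_one_iff_mul_self_le_one]
  linarith

lemma continuous_dotProduct_mulVec {n : ℕ} (a : Fin n → ℝ) (M : Matrix (Fin n) (Fin n) ℝ) :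
    Continuous fun x : Fin n → ℝ => a ⬝ᵥ M *ᵥ x := by
  fun_prop

lemma integral_dotProduct_mul_dotProduct {n : ℕ} {p : Measure (Fin n → ℝ)} [IsFiniteMeasure p]
    (hp : ∀ᵐ x ∂p, x ⬝ᵥ x ≤ 1) {Cov : Matrix (Fin n) (Fin n) ℝ}
    (hCov : ∀ i j, Cov i j = ∫ v, v i * v j ∂p) (a b : Fin n → ℝ) :
    ∫ v, (a ⬝ᵥ v) * (b ⬝ᵥ v) ∂p = a ⬝ᵥ Cov *ᵥ b := by
  have e : ∀ v : Fin n → ℝ,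
      (a ⬝ᵥ v) * (b ⬝ᵥ v) = ∑ i, ∑ j, (a i * b j) * (v i * v j) := by
    intro v
    simp only [dotProduct]
    rw [Finset.sum_mul_sum]
    exact Finset.sum_congr rfl fun i _ => Finset.sum_congr rfl fun j _ => by ring
  simp only [e]
  rw [integral_finsetSum _ fun i _ => integrable_of_ae_dotProduct_self_le hp (by fun_prop)]
  simp only [dotProduct, mulVec, hCov, Finset.mul_sum]
  refine Finset.sum_congr rfl fun i _ => ?_
  rw [integral_finsetSum _ fun i _ => integrable_of_ae_dotProduct_self_le hp (by fun_prop)]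
  refine Finset.sum_congr rfl fun j _ => ?_
  rw [integral_const_mul]
  ring

lemma integral_mul_dotProduct_mulVec {n : ℕ} {μ : Measure (Fin n → ℝ)} [IsFiniteMeasure μ]
    (hμ : ∀ᵐ x ∂μ, x ⬝ᵥ x ≤ 1) {f : (Fin n → ℝ) → ℝ} (hf : Continuous f)
    (M : Matrix (Fin n) (Fin n) ℝ) (a : Fin n → ℝ) :
    ∫ x, f x * (a ⬝ᵥ M *ᵥ x) ∂μ = a ⬝ᵥ fun i => ∫ x, f x * (M *ᵥ x) i ∂μ := by
  simp only [dotProduct, Finset.mul_sum]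
  rw [integral_finsetSum _ fun i _ => integrable_of_ae_dotProduct_self_le hμ
    (by simp only [mulVec, dotProduct]; fun_prop)]
  refine Finset.sum_congr rfl fun i _ => ?_
  rw [← integral_const_mul]
  exact integral_congr_ae (.of_forall fun x => by ring)

end Integration

section LinearTerm

open Matrix

lemma abs_sinh_le_cosh (x : ℝ) : |Real.sinh x| ≤ Real.cosh x := by
  rw [Real.abs_sinh, ← Real.cosh_abs]
  exact (Real.sinh_lt_cosh _).le

lemma abs_sinh_sub_two_le (x : ℝ) : |Real.sinh x| - 2 ≤ Real.sinh x * x := by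
  have h0 : Real.sinh x * x = Real.sinh |x| * |x| := by
    rcases abs_cases x with ⟨h, _⟩ | ⟨h, _⟩ <;> rw [h]
    rw [Real.sinh_neg]; ring
  rw [h0, Real.abs_sinh]
  have hs : 0 ≤ Real.sinh |x| := Real.sinh_nonneg_iff.2 (abs_nonneg x)
  by_cases h1 : 1 ≤ |x|
  · nlinarith
  · have h2 : Real.sinh |x| ≤ Real.sinh 1 := Real.sinh_le_sinh.2 (by linarith)
    have h3 : Real.sinh 1 ≤ 2 := by
      rw [Real.sinh_eq]
      linarith [Real.exp_one_lt_d9, Real.exp_pos (-1)]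
    nlinarith [mul_nonneg hs (abs_nonneg x)]

lemma abs_le_log_add_cosh (z : ℝ) {A : ℝ} (hA : 0 < A) :
    |z| ≤ Real.log A + 2 / A * Real.cosh z := by
  have h1 := Real.add_one_le_exp (|z| - Real.log A)
  rw [Real.exp_sub, Real.exp_log hA] at h1
  have h2 : Real.exp |z| ≤ 2 * Real.cosh z := by
    rw [← Real.cosh_abs, Real.cosh_eq]
    linarith [Real.exp_pos (-|z|)]
  have h3 : Real.exp |z| / A ≤ 2 / A * Real.cosh z := by
    rw [div_mul_eq_mul_div]
    gcongr
  linarith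

lemma linear_term_lower_bound_of_le {n κ : ℕ} {Cov : Matrix (Fin n) (Fin n) ℝ}
    {P : Fin κ → Matrix (Fin n) (Fin n) ℝ} {c : Fin κ → ℝ} (h : SpectralProjections Cov P c)
    (hc : ∀ k, 0 ≤ c k) (hcs : ∑ k, c k ≤ 1)
    {p q : Measure (Fin n → ℝ)} [IsProbabilityMeasure p] [IsProbabilityMeasure q]
    (hp : ∀ᵐ x ∂p, x ⬝ᵥ x ≤ 1) (hq : ∀ᵐ x ∂q, x ⬝ᵥ x ≤ 1)
    (hpq : ∀ f : (Fin n → ℝ) → ℝ, Continuous f → (∀ x, 0 ≤ f x) →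
      ∫ x, f x ∂p ≤ 2 * ∫ x, f x ∂q)
    (hCov : ∀ i j, Cov i j = ∫ v, v i * v j ∂p)
    {lam T B Φ : ℝ} (hlam : 0 < lam) (hT : 0 < T) (hΦ0 : 0 < Φ) (d : Fin n → ℝ)
    (hΦ : Φ = ∑ k, ∫ x, Real.cosh (lam * (d ⬝ᵥ P k *ᵥ x)) ∂q)
    (hB : B = κ * Real.log (4 * lam * Φ ^ 2 * T)) (hBlow : 2 * lam + 1 / T ≤ B)
    {L : (Fin n → ℝ) → ℝ}
    (hL : ∀ v, L v = lam * ∑ k,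
      ∫ x, Real.sinh (lam * (d ⬝ᵥ P k *ᵥ x)) * (v ⬝ᵥ P k *ᵥ x) ∂q) :
    lam / B * (∑ k, c k * ∫ x, |Real.sinh (lam * (d ⬝ᵥ P k *ᵥ x))| ∂q) - 1 ≤
      ∫ v, |L v| ∂p := by
  have hB0 : 0 < B := lt_of_lt_of_le (by positivity) hBlow
  have hz : ∀ k, Continuous fun x : Fin n → ℝ => lam * (d ⬝ᵥ P k *ᵥ x) := fun k =>
    continuous_const.mul (continuous_dotProduct_mulVec d (P k))
  have hsinh : ∀ k, Continuous fun x : Fin n → ℝ => Real.sinh (lam * (d ⬝ᵥ P k *ᵥ x)) :=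
    fun k => Real.continuous_sinh.comp (hz k)
  have hcosh : ∀ k, Continuous fun x : Fin n → ℝ => Real.cosh (lam * (d ⬝ᵥ P k *ᵥ x)) :=
    fun k => Real.continuous_cosh.comp (hz k)
  have hlin : ∀ (a : Fin n → ℝ) k, Continuous fun x : Fin n → ℝ => a ⬝ᵥ P k *ᵥ x :=
    fun a k => continuous_dotProduct_mulVec a (P k)
  set w : Fin κ → Fin n → ℝ := fun k i =>
    ∫ x, Real.sinh (lam * (d ⬝ᵥ P k *ᵥ x)) * (P k *ᵥ x) i ∂q with hw
  have hwdot : ∀ a k, ∫ x, Real.sinh (lam * (d ⬝ᵥ P k *ᵥ x)) * (a ⬝ᵥ P k *ᵥ x) ∂q = a ⬝ᵥ w k :=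
    fun a k => integral_mul_dotProduct_mulVec hq (hsinh k) (P k) a
  have hLW : ∀ v, L v = lam * ((∑ k, w k) ⬝ᵥ v) := by
    intro v
    rw [hL, dotProduct_comm, dotProduct_sum]
    simp only [hwdot]
  have hLc : Continuous L := by
    rw [funext hLW]
    fun_prop
  set u : Fin n → ℝ := (∑ k, P k) *ᵥ d with hu
  have hud : ∀ v, u ⬝ᵥ v = ∑ k, d ⬝ᵥ P k *ᵥ v := by
    intro v
    rw [hu, h.sum_symm.mulVec_dotProduct, sum_mulVec, dotProduct_sum]
  have huc : ∀ k, u ⬝ᵥ Cov *ᵥ w k = c k * (d ⬝ᵥ w k) := by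
    intro k
    rw [← h.cov_symm.mulVec_dotProduct, ← hwdot, ← hwdot, ← integral_const_mul]
    refine integral_congr_ae (.of_forall fun x => ?_)
    simp only
    rw [h.cov_symm.mulVec_dotProduct, h.cov_mulVec, dotProduct_smul, hu,
      h.sum_symm.mulVec_dotProduct, mulVec_mulVec, h.sum_mul, smul_eq_mul]
    ring
  have hLY : ∫ v, L v * (lam * (u ⬝ᵥ v)) ∂p =
      lam * ∑ k, c k * ∫ x, Real.sinh (lam * (d ⬝ᵥ P k *ᵥ x)) * (lam * (d ⬝ᵥ P k *ᵥ x)) ∂q := by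
    have e1 : ∀ v, L v * (lam * (u ⬝ᵥ v)) = lam ^ 2 * ((u ⬝ᵥ v) * ((∑ k, w k) ⬝ᵥ v)) := by
      intro v
      rw [hLW]
      ring
    simp only [e1]
    rw [integral_const_mul, integral_dotProduct_mul_dotProduct hp hCov, mulVec_sum,
      dotProduct_sum, sq, mul_assoc]
    congr 1
    rw [Finset.mul_sum]
    refine Finset.sum_congr rfl fun k _ => ?_
    rw [huc, ← hwdot, ← mul_assoc, mul_comm lam, mul_assoc, ← integral_const_mul]
    congr 1
    exact integral_congr_ae (.of_forall fun x => by ring)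
  have hcint : ∀ k, Integrable (fun x => Real.cosh (lam * (d ⬝ᵥ P k *ᵥ x))) p :=
    fun k => integrable_of_ae_dotProduct_self_le hp (hcosh k)
  have hLb : ∀ v : Fin n → ℝ, v ⬝ᵥ v ≤ 1 → |L v| ≤ lam * Φ := by
    intro v hv
    rw [hL, abs_mul, abs_of_pos hlam, hΦ]
    refine mul_le_mul_of_nonneg_left ((Finset.abs_sum_le_sum_abs _ _).trans
      (Finset.sum_le_sum fun k _ => abs_integral_le_integral_abs.trans ?_)) hlam.le
    refine integral_mono_ae
      (integrable_of_ae_dotProduct_self_le hq ((hsinh k).mul (hlin v k)).abs)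
      (integrable_of_ae_dotProduct_self_le hq (hcosh k)) ?_
    filter_upwards [hq] with x hx
    rw [abs_mul]
    have := h.abs_dotProduct_le zero_le_one (by simpa using hv) hx k
    calc _ ≤ Real.cosh (lam * (d ⬝ᵥ P k *ᵥ x)) * 1 :=
          mul_le_mul (abs_sinh_le_cosh _) this (abs_nonneg _) (Real.cosh_pos _).le
      _ = _ := mul_one _
  set A := 4 * lam * Φ ^ 2 * T with hA
  have hA0 : 0 < A := by positivity
  have hY : ∀ v, |lam * (u ⬝ᵥ v)| ≤ B + 2 / A * ∑ k, Real.cosh (lam * (d ⬝ᵥ P k *ᵥ v)) := by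
    intro v
    rw [hud, Finset.mul_sum]
    calc _ ≤ ∑ k, |lam * (d ⬝ᵥ P k *ᵥ v)| := Finset.abs_sum_le_sum_abs _ _
      _ ≤ ∑ k, (Real.log A + 2 / A * Real.cosh (lam * (d ⬝ᵥ P k *ᵥ v))) :=
        Finset.sum_le_sum fun k _ => abs_le_log_add_cosh _ hA0
      _ = _ := by simp [Finset.sum_add_distrib, Finset.mul_sum, hB]
  have hsumc : Continuous fun v : Fin n → ℝ => ∑ k, Real.cosh (lam * (d ⬝ᵥ P k *ᵥ v)) :=
    continuous_finsetSum _ fun k _ => hcosh k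
  have hupper : ∫ v, L v * (lam * (u ⬝ᵥ v)) ∂p ≤ B * (∫ v, |L v| ∂p) + 1 / T := by
    have i1 : Integrable (fun v => B * |L v|) p :=
      integrable_of_ae_dotProduct_self_le hp (continuous_const.mul hLc.abs)
    have i2 : Integrable (fun v => lam * Φ * (2 / A) *
        ∑ k, Real.cosh (lam * (d ⬝ᵥ P k *ᵥ v))) p :=
      integrable_of_ae_dotProduct_self_le hp (continuous_const.mul hsumc)
    calc ∫ v, L v * (lam * (u ⬝ᵥ v)) ∂p
        ≤ ∫ v, (B * |L v| + lam * Φ * (2 / A) *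
            ∑ k, Real.cosh (lam * (d ⬝ᵥ P k *ᵥ v))) ∂p := by
          refine integral_mono_ae (integrable_of_ae_dotProduct_self_le hp (by fun_prop)) (i1.add i2) ?_
          filter_upwards [hp] with v hv
          have hs : 0 ≤ 2 / A * ∑ k, Real.cosh (lam * (d ⬝ᵥ P k *ᵥ v)) :=
            mul_nonneg (by positivity) (Finset.sum_nonneg fun k _ => (Real.cosh_pos _).le)
          calc L v * (lam * (u ⬝ᵥ v)) ≤ |L v| * |lam * (u ⬝ᵥ v)| := by
                rw [← abs_mul]
                exact le_abs_self _
            _ ≤ |L v| * (B + 2 / A * ∑ k, Real.cosh (lam * (d ⬝ᵥ P k *ᵥ v))) :=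
                mul_le_mul_of_nonneg_left (hY v) (abs_nonneg _)
            _ = B * |L v| + |L v| * (2 / A * ∑ k, Real.cosh (lam * (d ⬝ᵥ P k *ᵥ v))) := by ring
            _ ≤ B * |L v| + lam * Φ * (2 / A * ∑ k, Real.cosh (lam * (d ⬝ᵥ P k *ᵥ v))) := by
                gcongr
                exact hLb v hv
            _ = _ := by ring
      _ = B * (∫ v, |L v| ∂p) + lam * Φ * (2 / A) *
            ∑ k, ∫ v, Real.cosh (lam * (d ⬝ᵥ P k *ᵥ v)) ∂p := by
          rw [integral_add i1 i2, integral_const_mul, integral_const_mul,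
            integral_finsetSum _ fun k _ => hcint k]
      _ ≤ B * (∫ v, |L v| ∂p) + lam * Φ * (2 / A) * (2 * Φ) := by
          gcongr
          rw [hΦ, Finset.mul_sum]
          exact Finset.sum_le_sum fun k _ => hpq _ (hcosh k) fun x => (Real.cosh_pos _).le
      _ = B * (∫ v, |L v| ∂p) + 1 / T := by
          rw [hA]
          field_simp
          ring
  have hlower : lam * (∑ k, c k * ∫ x, |Real.sinh (lam * (d ⬝ᵥ P k *ᵥ x))| ∂q) - 2 * lam ≤
      ∫ v, L v * (lam * (u ⬝ᵥ v)) ∂p := by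
    rw [hLY]
    have hk : ∀ k, c k * (∫ x, |Real.sinh (lam * (d ⬝ᵥ P k *ᵥ x))| ∂q) - 2 * c k ≤
        c k * ∫ x, Real.sinh (lam * (d ⬝ᵥ P k *ᵥ x)) * (lam * (d ⬝ᵥ P k *ᵥ x)) ∂q := by
      intro k
      have i1 := integrable_of_ae_dotProduct_self_le hq (hsinh k).abs
      have : (∫ x, |Real.sinh (lam * (d ⬝ᵥ P k *ᵥ x))| ∂q) - 2 ≤
          ∫ x, Real.sinh (lam * (d ⬝ᵥ P k *ᵥ x)) * (lam * (d ⬝ᵥ P k *ᵥ x)) ∂q := by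
        calc _ = ∫ x, (|Real.sinh (lam * (d ⬝ᵥ P k *ᵥ x))| - 2) ∂q := by
              rw [integral_sub i1 (integrable_const _)]
              simp
          _ ≤ _ := integral_mono (i1.sub (integrable_const _))
              (integrable_of_ae_dotProduct_self_le hq ((hsinh k).mul (hz k)))
              fun x => abs_sinh_sub_two_le _
      nlinarith [mul_le_mul_of_nonneg_left this (hc k)]
    have hsum := Finset.sum_le_sum fun k (_ : k ∈ Finset.univ) => hk k
    rw [Finset.sum_sub_distrib, ← Finset.mul_sum] at hsum
    nlinarith
  rw [div_mul_eq_mul_div, sub_le_iff_le_add, div_le_iff₀ hB0]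
  nlinarith

/-- Upper bound on the potential when all the exponents are small. -/
lemma sum_integral_cosh_le {n κ : ℕ} {Cov : Matrix (Fin n) (Fin n) ℝ}
    {P : Fin κ → Matrix (Fin n) (Fin n) ℝ} {c : Fin κ → ℝ} (h : SpectralProjections Cov P c)
    {q : Measure (Fin n → ℝ)} [IsProbabilityMeasure q] (hq : ∀ᵐ x ∂q, x ⬝ᵥ x ≤ 1)
    {lam : ℝ} (hlam : 0 ≤ lam) (hlam' : lam ≤ 1 / 1000) {d : Fin n → ℝ}
    (hd : d ⬝ᵥ d ≤ 3 ^ 2) :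
    ∑ k, ∫ x, Real.cosh (lam * (d ⬝ᵥ P k *ᵥ x)) ∂q ≤ κ + 4.51 * lam ^ 2 := by
  have hz : ∀ k, Continuous fun x : Fin n → ℝ => lam * (d ⬝ᵥ P k *ᵥ x) := fun k =>
    continuous_const.mul (continuous_dotProduct_mulVec d (P k))
  have hcosh : ∀ k, Integrable (fun x => Real.cosh (lam * (d ⬝ᵥ P k *ᵥ x))) q :=
    fun k => integrable_of_ae_dotProduct_self_le hq (Real.continuous_cosh.comp (hz k))
  have hbound : ∀ y : ℝ, y ^ 2 ≤ 9 → Real.cosh (lam * y) ≤ 1 + 4.51 / 9 * lam ^ 2 * y ^ 2 := by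
    intro y hy
    have hsq : (lam * y) ^ 2 / 2 ≤ 1 / 1000 := by
      rw [mul_pow]
      nlinarith [mul_le_mul hlam' hlam' hlam (by norm_num), sq_nonneg lam, sq_nonneg y]
    have h0 : 0 ≤ (lam * y) ^ 2 / 2 := by positivity
    have h1 := Real.abs_exp_sub_one_sub_id_le (x := (lam * y) ^ 2 / 2)
      (by rw [abs_of_nonneg h0]; linarith)
    have h2 := (abs_le.1 h1).2
    have h3 := Real.cosh_le_exp_half_sq (lam * y)
    have h4 : ((lam * y) ^ 2 / 2) ^ 2 ≤ 1 / 1000 * ((lam * y) ^ 2 / 2) := by nlinarith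
    nlinarith [sq_nonneg (lam * y)]
  rw [← integral_finsetSum _ fun k _ => hcosh k]
  calc ∫ x, ∑ k, Real.cosh (lam * (d ⬝ᵥ P k *ᵥ x)) ∂q
      ≤ ∫ _x, ((κ : ℝ) + 4.51 * lam ^ 2) ∂q := by
        refine integral_mono_ae (integrable_finsetSum _ fun k _ => hcosh k)
          (integrable_const _) ?_
        filter_upwards [hq] with x hx
        have hS := h.sum_dotProduct_sq_le d x
        have hS' : ∑ k, (d ⬝ᵥ P k *ᵥ x) ^ 2 ≤ 9 := by
          nlinarith [dotProduct_self_nonneg_real d, dotProduct_self_nonneg_real x]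
        calc ∑ k, Real.cosh (lam * (d ⬝ᵥ P k *ᵥ x))
            ≤ ∑ k, (1 + 4.51 / 9 * lam ^ 2 * (d ⬝ᵥ P k *ᵥ x) ^ 2) :=
              Finset.sum_le_sum fun k _ => hbound _ <|
                (Finset.single_le_sum (f := fun k => (d ⬝ᵥ P k *ᵥ x) ^ 2)
                  (fun j _ => sq_nonneg _) (Finset.mem_univ k)).trans hS'
          _ = κ + 4.51 / 9 * lam ^ 2 * ∑ k, (d ⬝ᵥ P k *ᵥ x) ^ 2 := by
              rw [Finset.sum_add_distrib, ← Finset.mul_sum]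
              simp
          _ ≤ κ + 4.51 / 9 * lam ^ 2 * 9 := by gcongr
          _ = κ + 4.51 * lam ^ 2 := by ring
    _ = κ + 4.51 * lam ^ 2 := by simp

/-- Lower bound on the potential. -/
lemma le_sum_integral_cosh {n κ : ℕ} (P : Fin κ → Matrix (Fin n) (Fin n) ℝ)
    {q : Measure (Fin n → ℝ)} [IsProbabilityMeasure q] (hq : ∀ᵐ x ∂q, x ⬝ᵥ x ≤ 1)
    (lam : ℝ) (d : Fin n → ℝ) :
    (κ : ℝ) ≤ ∑ k, ∫ x, Real.cosh (lam * (d ⬝ᵥ P k *ᵥ x)) ∂q := by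
  have hk : ∀ k, 1 ≤ ∫ x, Real.cosh (lam * (d ⬝ᵥ P k *ᵥ x)) ∂q := by
    intro k
    have hi := integrable_of_ae_dotProduct_self_le hq (Real.continuous_cosh.comp
      (continuous_const.mul (continuous_dotProduct_mulVec d (P k)) (f := fun _ => lam)))
    simpa using integral_mono (integrable_const (1 : ℝ)) hi fun x => Real.one_le_cosh _
  calc (κ : ℝ) = ∑ _k : Fin κ, (1 : ℝ) := by simp
    _ ≤ _ := Finset.sum_le_sum fun k _ => hk k

lemma sum_integral_abs_sinh_le {n κ : ℕ} {Cov : Matrix (Fin n) (Fin n) ℝ}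
    {P : Fin κ → Matrix (Fin n) (Fin n) ℝ} {c : Fin κ → ℝ} (h : SpectralProjections Cov P c)
    (hc : ∀ k, 0 ≤ c k) (hcs : ∑ k, c k ≤ 1)
    {q : Measure (Fin n → ℝ)} [IsProbabilityMeasure q] (hq : ∀ᵐ x ∂q, x ⬝ᵥ x ≤ 1)
    {lam : ℝ} (hlam : 0 ≤ lam) (hlam' : lam ≤ 1 / 1000) {d : Fin n → ℝ}
    (hd : d ⬝ᵥ d ≤ 3 ^ 2) :
    ∑ k, c k * ∫ x, |Real.sinh (lam * (d ⬝ᵥ P k *ᵥ x))| ∂q ≤ 3.1 * lam := by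
  have hz : ∀ k, Continuous fun x : Fin n → ℝ => lam * (d ⬝ᵥ P k *ᵥ x) := fun k =>
    continuous_const.mul (continuous_dotProduct_mulVec d (P k))
  have hsinh : Real.sinh (3 * lam) ≤ 3.1 * lam := by
    have h1 := (abs_le.1 (Real.abs_exp_sub_one_sub_id_le (x := 3 * lam)
      (by rw [abs_of_nonneg (by positivity)]; linarith))).2
    have h2 := Real.add_one_le_exp (-(3 * lam))
    rw [Real.sinh_eq]
    nlinarith
  have hk : ∀ k, ∫ x, |Real.sinh (lam * (d ⬝ᵥ P k *ᵥ x))| ∂q ≤ 3.1 * lam := by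
    intro k
    calc ∫ x, |Real.sinh (lam * (d ⬝ᵥ P k *ᵥ x))| ∂q ≤ ∫ _x, 3.1 * lam ∂q := by
          refine integral_mono_ae (integrable_of_ae_dotProduct_self_le hq
            (Real.continuous_sinh.comp (hz k)).abs) (integrable_const _) ?_
          filter_upwards [hq] with x hx
          refine le_trans ?_ hsinh
          rw [Real.abs_sinh, Real.sinh_le_sinh, abs_mul, abs_of_nonneg hlam, mul_comm]
          gcongr
          exact h.abs_dotProduct_le (by norm_num) hd hx k
      _ = 3.1 * lam := by simp
  calc _ ≤ ∑ k, c k * (3.1 * lam) :=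
        Finset.sum_le_sum fun k _ => mul_le_mul_of_nonneg_left (hk k) (hc k)
    _ = (∑ k, c k) * (3.1 * lam) := (Finset.sum_mul ..).symm
    _ ≤ 1 * (3.1 * lam) := by gcongr
    _ = _ := one_mul _

end LinearTerm

section Numerics

lemma exp_24_25_lower : (2.611696473423117 : ℝ) ≤ Real.exp (24 / 25) := by
  refine le_trans ?_ (Real.sum_le_exp_of_nonneg (by norm_num) 22)
  norm_num [Finset.sum_range_succ, Nat.factorial]

lemma exp_24_25_upper : Real.exp (24 / 25) ≤ (2.611696473423119 : ℝ) := by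
  refine (Real.exp_bound' (n := 22) (by norm_num) (by norm_num) (by norm_num)).trans ?_
  norm_num [Finset.sum_range_succ, Nat.factorial]

lemma log_bounds_of_pow_bounds {m : ℕ} {a η : ℝ} (ha : 0 < a) (hη : η < 1)
    (hlow : 3 * a ≤ 2.611696473423117 ^ m * (1 - η))
    (hupp : 2.611696473423119 ^ m ≤ (3 * a + 3) * (1 - η)) :
    Real.log (3 * a) ≤ 24 / 25 * m - η ∧ 24 / 25 * m + η ≤ Real.log (3 * a + 3) := by
  have hpow : Real.exp (24 / 25 * m) = Real.exp (24 / 25) ^ m := by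
    rw [← Real.exp_nat_mul, mul_comm]
  have hexp : 1 - η ≤ Real.exp (-η) := by linarith [Real.add_one_le_exp (-η)]
  constructor
  · rw [Real.log_le_iff_le_exp (by positivity), sub_eq_add_neg, Real.exp_add, hpow]
    refine hlow.trans (mul_le_mul ?_ hexp (by linarith) (by positivity))
    exact pow_le_pow_left₀ (by norm_num) exp_24_25_lower m
  · rw [Real.le_log_iff_exp_le (by positivity), Real.exp_add, hpow]
    calc Real.exp (24 / 25) ^ m * Real.exp η
        ≤ 2.611696473423119 ^ m * Real.exp η := by
          gcongr
          exact exp_24_25_upper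
      _ ≤ (3 * a + 3) * (1 - η) * Real.exp η := by gcongr
      _ ≤ (3 * a + 3) * Real.exp (-η) * Real.exp η := by gcongr
      _ = 3 * a + 3 := by rw [mul_assoc, ← Real.exp_add]; simp

/-- For `2 ≤ m ≤ 25`, no integer multiple of `3` has its logarithm very close to `24 m / 25`. -/
lemma exists_log_gap {m : ℕ} (h2 : 2 ≤ m) (h25 : m ≤ 25) :
    ∃ N : ℕ, 0 < N ∧
      Real.log (3 * N) ≤ 24 / 25 * m - 1.1 / (640000 * m ^ 2 * (m - 1) ^ 2) ∧
      24 / 25 * m + 1.1 / (640000 * m ^ 2 * (m - 1) ^ 2) ≤ Real.log (3 * N + 3) := by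
  let N : Fin 26 → ℕ := ![1, 1, 2, 5, 15, 40, 105, 276, 721, 1884, 4921, 12853, 33569, 87674,
    228979, 598024, 1561859, 4079103, 10653379, 27823393, 72666258, 189782210, 495653529,
    1294496574, 3380832139, 8829707376]
  refine ⟨N ⟨m, by omega⟩, ?_⟩
  interval_cases m <;> refine ⟨by norm_num [N], log_bounds_of_pow_bounds ?_ ?_ ?_ ?_⟩ <;>
    norm_num [N]

end Numerics

section Parameters

lemma log_mul_three_dichotomy {n m : ℕ} {l : ℝ} (hn : 0 < n) (hl : l = Real.log ((n : ℝ) * 3))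
    (hm2 : 2 ≤ m) (hml : (m : ℝ) - 1 < l) {lam : ℝ} (hlam : lam = (800 * m * l)⁻¹) :
    24 / 25 * m + 1.1 * lam ^ 2 ≤ l ∨ l ≤ 24 / 25 * m - 1.1 * lam ^ 2 := by
  have hm : (2 : ℝ) ≤ m := by exact_mod_cast hm2
  have hlam2 : 1.1 * lam ^ 2 ≤ 1.1 / (640000 * (m : ℝ) ^ 2 * (m - 1) ^ 2) := by
    rw [hlam, inv_pow, ← div_eq_mul_inv]
    have h1 : 0 < (m : ℝ) - 1 := by linarith
    have h2 : ((m : ℝ) - 1) ^ 2 ≤ l ^ 2 := by gcongr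
    have e : (800 * (m : ℝ) * l) ^ 2 = 640000 * m ^ 2 * l ^ 2 := by ring
    rw [e]
    gcongr
  by_cases h25 : m ≤ 25
  · obtain ⟨N, hN, h1, h2⟩ := exists_log_gap hm2 h25
    have hn' : (0 : ℝ) < n := by exact_mod_cast hn
    rcases le_or_gt n N with h | h
    · right
      have : l ≤ Real.log (3 * N) := by
        rw [hl, mul_comm]
        gcongr
      linarith
    · left
      have hN' : (N : ℝ) + 1 ≤ n := by exact_mod_cast h
      have : Real.log (3 * N + 3) ≤ l := by
        rw [hl]
        exact Real.log_le_log (by positivity) (by linarith)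
      linarith
  · left
    have h26 : (26 : ℝ) ≤ m := by exact_mod_cast (by omega : 26 ≤ m)
    have : 1.1 / (640000 * (m : ℝ) ^ 2 * (m - 1) ^ 2) ≤ 0.04 := by
      rw [div_le_iff₀ (by have : 0 < (m : ℝ) - 1 := by linarith
                          positivity)]
      have h1 : 1 ≤ (m : ℝ) ^ 2 := by nlinarith
      have h2 : 1 ≤ ((m : ℝ) - 1) ^ 2 := by nlinarith
      nlinarith [mul_le_mul h1 h2 (by norm_num) (by positivity)]
    linarith

lemma one_sub_inv_le_log_of_le {a x : ℝ} (ha : 0 < a) (h : a ≤ x) :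
    1 - a⁻¹ ≤ Real.log x :=
  (Real.one_sub_inv_le_log_of_pos ha).trans (Real.log_le_log ha h)

lemma div_mul_le_four_mul_sq {m l lam Φ T : ℝ} (hm : 0 < m) (hl : 0 < l) (hT : 0 ≤ T)
    (hlam : lam = (800 * m * l)⁻¹) (hΦ : 8 * m ≤ Φ) :
    0.32 * T * m / l ≤ 4 * lam * Φ ^ 2 * T := by
  have h1 : (8 * m) ^ 2 ≤ Φ ^ 2 := by gcongr
  have hlam0 : 0 < lam := by rw [hlam]; positivity
  calc 0.32 * T * m / l = 4 * lam * (8 * m) ^ 2 * T := by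
        rw [hlam]
        field_simp
        ring
    _ ≤ _ := by gcongr

lemma four_mul_sq_le_one {m l lam Φ T : ℝ} (hm : 2 ≤ m) (hl : 1 ≤ l) (hT : 0 ≤ T)
    (hT3 : T ≤ 3) (hlam : lam = (800 * m * l)⁻¹) (hΦ0 : 0 ≤ Φ)
    (hΦ : Φ ≤ 8 * m + 4.51 * lam ^ 2) (h : 0.32 * T * m + 1.1 * lam ^ 2 ≤ l) :
    4 * lam * Φ ^ 2 * T ≤ 1 := by
  have hlam0 : 0 < lam := by rw [hlam]; positivity
  have hlaml : lam * (800 * m * l) = 1 := by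
    rw [hlam]
    exact inv_mul_cancel₀ (by positivity)
  have hlam1 : lam ≤ 1 / 1000 := by
    rw [hlam, ← one_div]
    gcongr
    nlinarith
  have hs : lam ^ 2 ≤ 1 / 1000000 := by nlinarith
  have hsq : Φ ^ 2 ≤ 64 * m ^ 2 + 72.17 * m * lam ^ 2 := by
    calc Φ ^ 2 ≤ (8 * m + 4.51 * lam ^ 2) ^ 2 := by gcongr
      _ = 64 * m ^ 2 + 72.16 * m * lam ^ 2 + 4.51 ^ 2 * lam ^ 2 * lam ^ 2 := by ring
      _ ≤ 64 * m ^ 2 + 72.16 * m * lam ^ 2 + 4.51 ^ 2 * (1 / 1000000) * lam ^ 2 := by gcongr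
      _ ≤ _ := by nlinarith [sq_nonneg lam]
  calc 4 * lam * Φ ^ 2 * T ≤ 4 * lam * (64 * m ^ 2 + 72.17 * m * lam ^ 2) * T := by gcongr
    _ = 800 * m * lam * (0.32 * T * m + 0.36085 * lam ^ 2 * T) := by ring
    _ ≤ 800 * m * lam * (0.32 * T * m + 0.36085 * lam ^ 2 * 3) := by gcongr
    _ ≤ 800 * m * lam * l := by
        gcongr
        nlinarith [sq_nonneg lam]
    _ = 1 := by rw [← hlaml]; ring

end Parameters

section Mixture

lemma isProbabilityMeasure_uniform_dirac {α : Type*} [MeasurableSpace α] {S : Finset α}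
    (hS : S.Nonempty) :
    IsProbabilityMeasure ((S.card : ENNReal)⁻¹ • ∑ z ∈ S, Measure.dirac z) := by
  constructor
  simp only [Measure.smul_apply, Measure.finsetSum_apply, measure_univ, Finset.sum_const,
    smul_eq_mul, nsmul_eq_mul, mul_one]
  exact ENNReal.inv_mul_cancel (by simpa using hS.ne_empty) (by simp)

lemma isProbabilityMeasure_half_add_half {α : Type*} [MeasurableSpace α] (p ν : Measure α)
    [IsProbabilityMeasure p] [IsProbabilityMeasure ν] :
    IsProbabilityMeasure ((2⁻¹ : ENNReal) • p + (2⁻¹ : ENNReal) • ν) := by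
  constructor
  simp [ENNReal.inv_two_add_inv_two]

lemma ae_uniform_dirac {n : ℕ} {S : Finset (Fin n → ℝ)} {r : (Fin n → ℝ) → Prop}
    (hr : ∀ z ∈ S, r z) :
    ∀ᵐ x ∂((S.card : ENNReal)⁻¹ • ∑ z ∈ S, Measure.dirac z), r x := by
  refine Measure.ae_smul_measure ?_ _
  rw [ae_iff, Measure.finsetSum_apply]
  refine Finset.sum_eq_zero fun z hz => ?_
  have : ∀ᵐ x ∂Measure.dirac z, r x := by
    rw [ae_dirac_eq]
    exact hr z hz
  exact this

lemma integral_le_two_mul_integral_half_add {α : Type*} [MeasurableSpace α] {p ν : Measure α}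
    {f : α → ℝ} (hfp : Integrable f p) (hfν : Integrable f ν) (hf : ∀ x, 0 ≤ f x) :
    ∫ x, f x ∂p ≤ 2 * ∫ x, f x ∂((2⁻¹ : ENNReal) • p + (2⁻¹ : ENNReal) • ν) := by
  rw [integral_add_measure (hfp.smul_measure (by simp)) (hfν.smul_measure (by simp)),
    integral_smul_measure, integral_smul_measure]
  have : 0 ≤ ∫ x, f x ∂ν := integral_nonneg hf
  simp only [ENNReal.toReal_inv, ENNReal.toReal_ofNat, smul_eq_mul]
  linarith

end Mixture

lemma sum_two_zpow_neg_le_one (κ : ℕ) : ∑ k : Fin κ, (2 : ℝ) ^ (-(k.1 + 1 : ℤ)) ≤ 1 := by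
  have h : ∀ κ : ℕ, ∑ k ∈ Finset.range κ, (2 : ℝ) ^ (-(k + 1 : ℤ)) = 1 - (2 : ℝ) ^ (-(κ : ℤ)) := by
    intro κ
    induction κ with
    | zero => simp
    | succ κ ih =>
      rw [Finset.sum_range_succ, ih]
      have : (2 : ℝ) ^ (-(κ : ℤ)) = 2 * (2 : ℝ) ^ (-(κ + 1 : ℤ)) := by
        rw [← zpow_one_add₀ two_ne_zero]
        congr 1
        ring
      push_cast
      linarith
  rw [Fin.sum_univ_eq_sum_range (fun k : ℕ => (2 : ℝ) ^ (-(k + 1 : ℤ))), h]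
  linarith [zpow_pos (two_pos : (0 : ℝ) < 2) (-(κ : ℤ))]

/-- **Lower bounding the linear term** (Claim 5.5).  In the Komlós drift analysis, with
`B = κ log(4λΦ²T)` and `L(v) = λ ∑_k E_{x∼p_x}[sinh(λ⟨d,Π_k x⟩)⟨v,Π_k x⟩]`, one has
`E_{v∼p}[|L(v)|] ≥ (λ/B) ∑_k 2^{-k} E_{x∼p_x}[|sinh(λ⟨d,Π_k x⟩)|] − 1`. -/
theorem linear_term_lower_bound (n T : ℕ) (hn : 2 ≤ n) (hT : 2 ≤ T)
    (κ : ℕ) (hκ : κ = 8 * ⌈Real.log ((n : ℝ) * T)⌉₊)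
    (p : Measure (Fin n → ℝ)) [IsProbabilityMeasure p]
    (hsupp : ∀ᵐ v ∂p, euclNorm v ≤ 1)
    (hmean : ∫ v, v ∂p = 0)
    (Cov : Matrix (Fin n) (Fin n) ℝ)
    (hCov : ∀ i j, Cov i j = ∫ v, v i * v j ∂p)
    (hdyadic : ∀ (μ : ℝ) (x : Fin n → ℝ), x ≠ 0 → Cov.mulVec x = μ • x →
      μ = 0 ∨ ∃ k : ℕ, 1 ≤ k ∧ k ≤ κ ∧ μ = (2:ℝ) ^ (-(k : ℤ)))
    (P : Fin κ → Matrix (Fin n) (Fin n) ℝ)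
    (hsymm : ∀ k, (P k).IsSymm) (hidem : ∀ k, P k * P k = P k)
    (hrange : ∀ (k : Fin κ) (x : Fin n → ℝ),
      (P k).mulVec x = x ↔ Cov.mulVec x = ((2:ℝ) ^ (-(k.1 + 1 : ℤ))) • x)
    (S : Finset (Fin n → ℝ)) (hS : S.Nonempty)
    (hSnorm : ∀ z ∈ S, euclNorm z ≤ 1)
    (px : Measure (Fin n → ℝ))
    (hpx : px = (2⁻¹ : ENNReal) • p +
      (2⁻¹ : ENNReal) • (S.card : ENNReal)⁻¹ • ∑ z ∈ S, Measure.dirac z)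
    (lam : ℝ) (hlam : lam = (100 * κ * Real.log ((n : ℝ) * T))⁻¹)
    (d : Fin n → ℝ) (hd : euclNorm d ≤ T)
    (Φ : ℝ)
    (hΦ : Φ = ∑ k : Fin κ, ∫ x, Real.cosh (lam * euclDot d ((P k).mulVec x)) ∂px)
    (B : ℝ) (hB : B = κ * Real.log (4 * lam * Φ ^ 2 * T))
    (L : (Fin n → ℝ) → ℝ)
    (hL : ∀ v, L v = lam * ∑ k : Fin κ,
      ∫ x, Real.sinh (lam * euclDot d ((P k).mulVec x)) * euclDot v ((P k).mulVec x) ∂px) :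
    (∫ v, |L v| ∂p) ≥
      (lam / B) * (∑ k : Fin κ, (2:ℝ) ^ (-(k.1 + 1 : ℤ)) *
          ∫ x, |Real.sinh (lam * euclDot d ((P k).mulVec x))| ∂px) - 1 := by
  have hsupp' : ∀ᵐ x ∂p, x ⬝ᵥ x ≤ 1 := by
    filter_upwards [hsupp] with x hx
    simpa using (euclNorm_le_iff x zero_le_one).1 hx
  have hSnorm' : ∀ z ∈ S, z ⬝ᵥ z ≤ 1 := fun z hz => by
    simpa using (euclNorm_le_iff z zero_le_one).1 (hSnorm z hz)
  have hd' : d ⬝ᵥ d ≤ (T : ℝ) ^ 2 := (euclNorm_le_iff d (Nat.cast_nonneg T)).1 hd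
  simp only [euclDot_eq_dotProduct] at hΦ hL ⊢
  set c : Fin κ → ℝ := fun k => (2 : ℝ) ^ (-(k.1 + 1 : ℤ)) with hc
  have hc0 : ∀ k, 0 ≤ c k := fun k => (zpow_pos two_pos _).le
  have hcs : ∑ k, c k ≤ 1 := sum_two_zpow_neg_le_one κ
  have hspec : SpectralProjections Cov P c := by
    refine ⟨?_, hsymm, hidem, ?_, ?_⟩
    · ext i j
      rw [Matrix.transpose_apply, hCov, hCov]
      simp only [mul_comm]
    · intro j k hjk
      have := zpow_right_injective₀ (two_pos : (0 : ℝ) < 2) (by norm_num) hjk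
      ext
      omega
    · intro k x
      exact (hrange k _).1 (by rw [Matrix.mulVec_mulVec, hidem])
  set ν := (S.card : ENNReal)⁻¹ • ∑ z ∈ S, Measure.dirac z with hν
  have : IsProbabilityMeasure ν := isProbabilityMeasure_uniform_dirac hS
  have hν1 : ∀ᵐ x ∂ν, x ⬝ᵥ x ≤ 1 := ae_uniform_dirac hSnorm'
  have : IsProbabilityMeasure px := hpx ▸ isProbabilityMeasure_half_add_half p ν
  have hpx1 : ∀ᵐ x ∂px, x ⬝ᵥ x ≤ 1 := by
    rw [hpx, ae_add_measure_iff]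
    exact ⟨Measure.ae_smul_measure hsupp' _, Measure.ae_smul_measure hν1 _⟩
  have hpq : ∀ f : (Fin n → ℝ) → ℝ, Continuous f → (∀ x, 0 ≤ f x) →
      ∫ x, f x ∂p ≤ 2 * ∫ x, f x ∂px := fun f hf h0 => hpx ▸
    integral_le_two_mul_integral_half_add (integrable_of_ae_dotProduct_self_le hsupp' hf)
      (integrable_of_ae_dotProduct_self_le hν1 hf) h0
  have hn' : (2 : ℝ) ≤ n := by exact_mod_cast hn
  have hT' : (2 : ℝ) ≤ T := by exact_mod_cast hT
  set l := Real.log ((n : ℝ) * T) with hl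
  set m := ⌈l⌉₊ with hm
  have hl4 : 1.38 ≤ l := by
    have h4 : Real.log 4 = 2 * Real.log 2 := by
      rw [← Real.log_rpow two_pos]
      norm_num
    have : Real.log 4 ≤ l := Real.log_le_log (by norm_num) (by nlinarith)
    linarith [Real.log_two_gt_d9]
  have hlm : l ≤ m := Nat.le_ceil l
  have hml : (m : ℝ) - 1 < l := by linarith [Nat.ceil_lt_add_one (by linarith : 0 ≤ l)]
  have hm2 : 2 ≤ m := by
    have : (1 : ℝ) < m := by linarith
    exact_mod_cast this
  have hm2' : (2 : ℝ) ≤ m := by exact_mod_cast hm2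
  have hκ' : (κ : ℝ) = 8 * m := by rw [hκ]; push_cast; rfl
  have hlam' : lam = (800 * m * l)⁻¹ := by
    rw [hlam, hκ']
    congr 1
    ring
  have hlam0 : 0 < lam := by rw [hlam']; positivity
  have hlam1 : lam ≤ 1 / 1000 := by
    rw [hlam', ← one_div]
    gcongr
    nlinarith
  have hΦlow : 8 * (m : ℝ) ≤ Φ := by
    rw [← hκ', hΦ]
    exact le_sum_integral_cosh P hpx1 lam d
  have hΦ0 : 0 < Φ := by linarith
  have hLnonneg : 0 ≤ ∫ v, |L v| ∂p := integral_nonneg fun v => abs_nonneg _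
  have hA := div_mul_le_four_mul_sq (T := T) (by linarith) (by linarith) (by linarith) hlam' hΦlow
  rw [ge_iff_le]
  rcases le_or_gt 4 T with hT4 | hT4
  · refine linear_term_lower_bound_of_le hspec hc0 hcs hsupp' hpx1 hpq hCov hlam0
      (by linarith) hΦ0 d hΦ hB ?_ hL
    have hT4' : (4 : ℝ) ≤ T := by exact_mod_cast hT4
    have h1 : 1.28 ≤ 0.32 * T * m / l := by
      rw [le_div_iff₀ (by linarith)]
      nlinarith
    have h2 := one_sub_inv_le_log_of_le (by norm_num) (h1.trans hA)
    have h3 : 1 / (T : ℝ) ≤ 1 / 4 := by gcongr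
    rw [hB, hκ']
    norm_num at h2 h3 ⊢
    nlinarith
  · have hT3 : (T : ℝ) ≤ 3 := by exact_mod_cast (by omega : T ≤ 3)
    have hd3 : d ⬝ᵥ d ≤ 3 ^ 2 := hd'.trans (by gcongr)
    have hΦup : Φ ≤ 8 * m + 4.51 * lam ^ 2 := by
      rw [← hκ', hΦ]
      exact sum_integral_cosh_le hspec hpx1 hlam0.le hlam1 hd3
    have hsum0 : 0 ≤ ∑ k, c k * ∫ x, |Real.sinh (lam * (d ⬝ᵥ (P k).mulVec x))| ∂px :=
      Finset.sum_nonneg fun k _ => mul_nonneg (hc0 k) (integral_nonneg fun x => abs_nonneg _)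
    have hsum := sum_integral_abs_sinh_le hspec hc0 hcs hpx1 hlam0.le hlam1 hd3
    have hBcases : B ≤ 0 ∨ 3.1 * lam ^ 2 ≤ B := by
      have hneg : 0.32 * T * m + 1.1 * lam ^ 2 ≤ l → B ≤ 0 := fun h => by
        rw [hB]
        exact mul_nonpos_of_nonneg_of_nonpos (Nat.cast_nonneg κ) (Real.log_nonpos (by positivity)
          (four_mul_sq_le_one hm2' (by linarith) (by linarith) hT3 hlam' hΦ0.le hΦup h))
      obtain rfl | rfl : T = 2 ∨ T = 3 := by omega
      · left
        refine hneg ?_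
        have h1 : lam ^ 2 ≤ 1 / 1000000 := by nlinarith
        have h2 : (m : ℝ) ≤ 1.5 * l := by
          rcases le_or_gt l 2 with h | h
          · have : (m : ℝ) ≤ 2 := by exact_mod_cast Nat.ceil_le.2 (by exact_mod_cast h)
            linarith
          · linarith
        norm_num at h2 ⊢
        linarith
      · rcases log_mul_three_dichotomy (n := n) (by omega) (by rw [hl]; norm_num) hm2 hml hlam' with h | h
        · left
          refine hneg ?_
          norm_num at h ⊢
          linarith
        · right
          have h2 := one_sub_inv_le_log_of_le (by positivity) hA
          rw [inv_div] at h2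
          have h3 : 1 - l / (0.32 * (3 : ℕ) * m) = (24 / 25 * m - l) / (24 / 25 * m) := by
            push_cast
            field_simp
            ring
          rw [h3] at h2
          have h4 : 1.1 * lam ^ 2 / (24 / 25 * m) ≤ (24 / 25 * m - l) / (24 / 25 * m) := by
            gcongr
            linarith
          rw [hB, hκ']
          calc 3.1 * lam ^ 2 ≤ 8 * m * (1.1 * lam ^ 2 / (24 / 25 * m)) := by
                field_simp
                norm_num
            _ ≤ _ := by
                gcongr
                exact h4.trans h2
    rcases hBcases with hB0 | hBlow
    · have : lam / B * ∑ k, c k * ∫ x, |Real.sinh (lam * (d ⬝ᵥ (P k).mulVec x))| ∂px ≤ 0 :=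
        mul_nonpos_of_nonpos_of_nonneg (div_nonpos_of_nonneg_of_nonpos hlam0.le hB0) hsum0
      linarith
    · have hB0 : 0 < B := lt_of_lt_of_le (by positivity) hBlow
      have : lam / B * ∑ k, c k * ∫ x, |Real.sinh (lam * (d ⬝ᵥ (P k).mulVec x))| ∂px ≤ 1 := by
        rw [div_mul_eq_mul_div, div_le_one hB0]
        refine le_trans ?_ hBlow
        nlinarith
      linarith
end

section
/- For every λ ∈ (0,1] and all real numbers a, b with |a − b| ≤ 1, one has cosh(λa) − cosh(λb) ≤ λ·sinh(λb)·(a−b) + λ²·|sinh(λb)|·(a−b)² + λ²·(a−b)². -/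
/-- Bound on the second-order remainder of `cosh` at `y` for an increment of size at most one. -/
lemma cosh_add_sub_cosh_le {y d : ℝ} (hd : |d| ≤ 1) :
    Real.cosh (y + d) - Real.cosh y ≤
      d * Real.sinh y + d ^ 2 * |Real.sinh y| + d ^ 2 := by
  have hpos := (abs_le.mp (Real.abs_exp_sub_one_sub_id_le hd)).2
  have hneg := (abs_le.mp (Real.abs_exp_sub_one_sub_id_le ((abs_neg d).trans_le hd))).2
  rw [neg_sq] at hneg
  have hcosh : Real.cosh y ≤ 1 + |Real.sinh y| := by
    refine abs_le_of_sq_le_sq' ?_ (by positivity) |>.2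
    nlinarith [Real.cosh_sq y, sq_abs (Real.sinh y), abs_nonneg (Real.sinh y)]
  have hd_sum : Real.cosh d - 1 + |Real.sinh d - d| ≤ d ^ 2 := by
    rw [← le_sub_iff_add_le', abs_le, Real.cosh_eq, Real.sinh_eq]
    constructor <;> linarith
  have hd_cosh : 0 ≤ Real.cosh d - 1 := sub_nonneg.mpr (Real.one_le_cosh d)
  have hsinh : Real.sinh y * (Real.sinh d - d) ≤ |Real.sinh y| * |Real.sinh d - d| :=
    (le_abs_self _).trans_eq (abs_mul _ _)
  rw [Real.cosh_add]
  linarith [mul_le_mul_of_nonneg_right hcosh hd_cosh,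
    mul_le_mul_of_nonneg_left hd_sum (abs_nonneg (Real.sinh y)), abs_nonneg (Real.sinh d - d)]

/-- **Second-order Taylor-type bound for `cosh` with bounded increment.**  For every
`λ ∈ (0,1]` and all reals `a, b` with `|a − b| ≤ 1`,
`cosh(λa) − cosh(λb) ≤ λ sinh(λb)(a−b) + λ²|sinh(λb)|(a−b)² + λ²(a−b)²`. -/
theorem cosh_taylor_bounded_increment (lam a b : ℝ) (h0 : 0 < lam) (h1 : lam ≤ 1)
    (hab : |a - b| ≤ 1) :
    Real.cosh (lam * a) - Real.cosh (lam * b) ≤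
      lam * Real.sinh (lam * b) * (a - b) +
        lam ^ 2 * |Real.sinh (lam * b)| * (a - b) ^ 2 + lam ^ 2 * (a - b) ^ 2 := by
  have hd : |lam * (a - b)| ≤ 1 := by
    rw [abs_mul, abs_of_pos h0]
    exact mul_le_one₀ h1 (abs_nonneg _) hab
  have h := cosh_add_sub_cosh_le (y := lam * b) hd
  rw [← mul_add, add_sub_cancel] at h
  linarith
end

section
/- For every λ ∈ [0,1] and all real numbers a, b, one has cosh(λa) − cosh(λb) ≤ λ·sinh(λb)·(a−b) + (λ²/2)·cosh(λb)·e^{|a−b|}·(a−b)². -/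
theorem Real.exp_le_one_add_add_sq_mul_exp_abs (x : ℝ) :
    Real.exp x ≤ 1 + x + x ^ 2 / 2 * Real.exp |x| := by
  rcases le_total 0 x with hx | hx
  · rw [abs_of_nonneg hx]
    have hderiv (y : ℝ) : HasDerivAt (fun t ↦ 1 + t + t ^ 2 / 2 * Real.exp t - Real.exp t)
        (1 + (y + y ^ 2 / 2 - 1) * Real.exp y) y := by
      have h := (((hasDerivAt_id y).const_add 1).add
        ((((hasDerivAt_id y).pow 2).div_const 2).mul (Real.hasDerivAt_exp y))).sub
        (Real.hasDerivAt_exp y)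
      refine h.congr_deriv ?_
      simp only [id, Pi.pow_apply]
      norm_num
      ring
    have hmono : Monotone fun t : ℝ ↦ 1 + t + t ^ 2 / 2 * Real.exp t - Real.exp t := by
      refine monotone_of_hasDerivAt_nonneg hderiv fun y ↦ ?_
      have hneg : Real.exp (-y) * Real.exp y = 1 := by rw [← Real.exp_add]; simp
      have hlin := Real.add_one_le_exp (-y)
      have hcoef : 0 ≤ Real.exp (-y) + (y + y ^ 2 / 2 - 1) := by nlinarith [sq_nonneg y]
      have hprod := mul_nonneg hcoef (Real.exp_pos y).le
      rw [add_mul, hneg] at hprod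
      exact hprod
    have h := hmono hx
    norm_num at h
    linarith
  · have hquad := Real.quadratic_le_exp_of_nonneg (neg_nonneg.2 hx)
    have hneg : Real.exp (-x) * Real.exp x = 1 := by rw [← Real.exp_add]; simp
    have hsq : Real.exp x ≤ 1 + x + x ^ 2 / 2 := by
      have hpos : 0 ≤ 1 + x + x ^ 2 / 2 := by nlinarith [sq_nonneg (x + 1)]
      have hone : 1 ≤ (1 + x + x ^ 2 / 2) * Real.exp (-x) := by
        nlinarith [mul_le_mul_of_nonneg_left hquad hpos, sq_nonneg (x ^ 2)]
      nlinarith [mul_le_mul_of_nonneg_right hone (Real.exp_pos x).le]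
    have hexp : 1 ≤ Real.exp |x| := Real.one_le_exp (abs_nonneg x)
    nlinarith [mul_le_mul_of_nonneg_left hexp (sq_nonneg x)]

theorem Real.cosh_add_le_taylor (y d : ℝ) :
    Real.cosh (y + d) ≤
      Real.cosh y + Real.sinh y * d + d ^ 2 / 2 * Real.cosh y * Real.exp |d| := by
  have hpos := mul_le_mul_of_nonneg_left (Real.exp_le_one_add_add_sq_mul_exp_abs d)
    (Real.exp_pos y).le
  have hneg := mul_le_mul_of_nonneg_left (Real.exp_le_one_add_add_sq_mul_exp_abs (-d))
    (Real.exp_pos (-y)).le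
  rw [abs_neg] at hneg
  rw [Real.cosh_eq, Real.cosh_eq, Real.sinh_eq, neg_add, Real.exp_add, Real.exp_add]
  linarith

/-- **Taylor-type bound for `cosh` with arbitrary increment.**  For every `λ ∈ [0,1]` and all
reals `a, b`, `cosh(λa) − cosh(λb) ≤ λ sinh(λb)(a−b) + (λ²/2) cosh(λb) e^{|a−b|} (a−b)²`. -/
theorem cosh_taylor_exponential_increment (lam a b : ℝ) (h0 : 0 ≤ lam) (h1 : lam ≤ 1) :
    Real.cosh (lam * a) - Real.cosh (lam * b) ≤
      lam * Real.sinh (lam * b) * (a - b) +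
        lam ^ 2 / 2 * Real.cosh (lam * b) * Real.exp |a - b| * (a - b) ^ 2 := by
  have h := Real.cosh_add_le_taylor (lam * b) (lam * (a - b))
  rw [show lam * b + lam * (a - b) = lam * a by ring] at h
  have habs : |lam * (a - b)| ≤ |a - b| := by
    rw [abs_mul, abs_of_nonneg h0]
    exact mul_le_of_le_one_left (abs_nonneg _) h1
  have hcoef : 0 ≤ (lam * (a - b)) ^ 2 / 2 * Real.cosh (lam * b) := by
    have := Real.cosh_pos (lam * b)
    positivity
  linarith [mul_le_mul_of_nonneg_left (Real.exp_le_exp.2 habs) hcoef]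
end

section
/- Let (Ω, F, P) be a probability space with a filtration F_0 ⊆ F_1 ⊆ ⋯ ⊆ F_T, and let (Φ_t)_{t=0}^T be a nonnegative integrable adapted process with Φ_0 ≤ a almost surely for a constant a ≥ 0. Let c ≥ 0 and M > 0, and suppose that for each t ∈ {1,…,T}, on the event A_{t−1} = {Φ_s ≤ M for all s ≤ t−1} one has E[Φ_t | F_{t−1}] ≤ Φ_{t−1} + c almost surely. Then P( max_{0 ≤ t ≤ T} Φ_t > M ) ≤ (a + cT)/M. -/
open MeasureTheory

/-- A Markov-type inequality on a set `S`: the part of `S` where `f` exceeds `M` contributes at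
least `M` times its measure to the integral of `f` over `S`. -/
theorem setIntegral_inter_add_mul_measureReal_sdiff_le {Ω : Type*} {m0 : MeasurableSpace Ω}
    {μ : Measure Ω} [IsFiniteMeasure μ] {f : Ω → ℝ} {S : Set Ω} (M : ℝ)
    (hS : MeasurableSet S) (hf : Measurable f) (hint : Integrable f μ) :
    ∫ ω in S ∩ {ω | f ω ≤ M}, f ω ∂μ + M * μ.real (S \ {ω | f ω ≤ M}) ≤ ∫ ω in S, f ω ∂μ := by
  have hB : MeasurableSet {ω | f ω ≤ M} := measurableSet_le hf measurable_const
  have hM : ∫ _ in S \ {ω | f ω ≤ M}, M ∂μ ≤ ∫ ω in S \ {ω | f ω ≤ M}, f ω ∂μ :=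
    setIntegral_mono_on (integrable_const M).integrableOn hint.integrableOn (hS.diff hB)
      fun ω hω => (not_le.mp hω.2).le
  rw [setIntegral_const, smul_eq_mul, mul_comm] at hM
  rw [← integral_inter_add_sdiff (s := S) hB hint.integrableOn]
  gcongr

/-- If the conditional drift of `g` given `m` exceeds `f` by at most `c` on an `m`-measurable
set, then so do the integrals over that set. -/
theorem setIntegral_le_setIntegral_add_of_condExp_le {Ω : Type*} {m m0 : MeasurableSpace Ω}
    {μ : Measure Ω} [IsProbabilityMeasure μ] (hm : m ≤ m0) {f g : Ω → ℝ} {S : Set Ω} {c : ℝ}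
    (hc : 0 ≤ c) (hS : MeasurableSet[m] S) (hf : Integrable f μ) (hg : Integrable g μ)
    (h : ∀ᵐ ω ∂μ, ω ∈ S → (μ[g | m]) ω ≤ f ω + c) :
    ∫ ω in S, g ω ∂μ ≤ ∫ ω in S, f ω ∂μ + c := by
  have hle : ∫ ω in S, (μ[g | m]) ω ∂μ ≤ ∫ ω in S, (f ω + c) ∂μ :=
    setIntegral_mono_on_ae integrable_condExp.integrableOn
      (hf.add (integrable_const c)).integrableOn (hm S hS) h
  rw [setIntegral_condExp hm hg hS,
    integral_add hf.integrableOn (integrable_const c).integrableOn,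
    setIntegral_const, smul_eq_mul] at hle
  have := mul_le_of_le_one_left hc (measureReal_le_one (μ := μ) (s := S))
  linarith

/-- **The truncation/stopping argument.**  Let `(Φ_t)_{t=0}^T` be a nonnegative integrable
adapted process with `Φ₀ ≤ a` a.s., and suppose that for each `1 ≤ t ≤ T`, a.e. on the event
`A_{t−1} = {Φ_s ≤ M for all s ≤ t−1}` one has `E[Φ_t | F_{t−1}] ≤ Φ_{t−1} + c`.  Then
`P(max_{t ≤ T} Φ_t > M) ≤ (a + cT)/M`. -/
theorem stopped_process_markov_bound
    {Ω : Type*} {m0 : MeasurableSpace Ω} (P : Measure Ω) [IsProbabilityMeasure P]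
    (ℱ : Filtration ℕ m0) (T : ℕ) (Φ : ℕ → Ω → ℝ)
    (hnonneg : ∀ t ≤ T, ∀ ω, 0 ≤ Φ t ω)
    (hint : ∀ t ≤ T, Integrable (Φ t) P)
    (hadapted : ∀ t ≤ T, StronglyMeasurable[ℱ t] (Φ t))
    (a : ℝ) (ha : 0 ≤ a) (h0 : ∀ᵐ ω ∂P, Φ 0 ω ≤ a)
    (c : ℝ) (hc : 0 ≤ c) (M : ℝ) (hM : 0 < M)
    (hdrift : ∀ t, 1 ≤ t → t ≤ T →
      ∀ᵐ ω ∂P, (∀ s ≤ t - 1, Φ s ω ≤ M) →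
        (P[Φ t | ℱ (t - 1)]) ω ≤ Φ (t - 1) ω + c) :
    P {ω | ∃ t ≤ T, M < Φ t ω} ≤ ENNReal.ofReal ((a + c * T) / M) := by
  set A : ℕ → Set Ω := fun t => {ω | ∀ s ≤ t, Φ s ω ≤ M} with hA
  have hA_zero : A 0 = Set.univ ∩ {ω | Φ 0 ω ≤ M} := by
    ext ω
    simp [hA]
  have hA_succ (t : ℕ) : A (t + 1) = A t ∩ {ω | Φ (t + 1) ω ≤ M} := by
    ext ω
    simp [hA, Nat.le_succ_iff, or_imp, forall_and]
  have hA_meas (t : ℕ) (ht : t ≤ T) : MeasurableSet[ℱ t] (A t) := by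
    have : A t = ⋂ s, ⋂ _ : s ≤ t, {ω | Φ s ω ≤ M} := by
      ext ω
      simp [hA]
    rw [this]
    exact MeasurableSet.iInter fun s => MeasurableSet.iInter fun hs =>
      ℱ.mono hs _ ((hadapted s (hs.trans ht)).measurable measurableSet_Iic)
  have hΦ_meas (t : ℕ) (ht : t ≤ T) : Measurable (Φ t) :=
    (hadapted t ht).measurable.mono (ℱ.le t) le_rfl
  have key (t : ℕ) (ht : t ≤ T) :
      ∫ ω in A t, Φ t ω ∂P + M * P.real (A t)ᶜ ≤ a + c * t := by
    induction t with
    | zero =>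
      have h := setIntegral_inter_add_mul_measureReal_sdiff_le M MeasurableSet.univ
        (hΦ_meas 0 ht) (hint 0 ht)
      have h_le : ∫ ω, Φ 0 ω ∂P ≤ a := by
        simpa using integral_mono_ae (hint 0 ht) (integrable_const a) h0
      have hcompl : (A 0)ᶜ = Set.univ \ {ω | Φ 0 ω ≤ M} := by
        rw [hA_zero, Set.univ_inter, Set.compl_eq_univ_sdiff]
      rw [← hA_zero, ← hcompl, setIntegral_univ] at h
      simpa using h.trans h_le
    | succ t ih =>
      have ht' : t ≤ T := t.le_succ.trans ht
      have hAt : MeasurableSet (A t) := ℱ.le t _ (hA_meas t ht')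
      have h := setIntegral_inter_add_mul_measureReal_sdiff_le M hAt
        (hΦ_meas (t + 1) ht) (hint (t + 1) ht)
      have hd := setIntegral_le_setIntegral_add_of_condExp_le (ℱ.le t) hc (hA_meas t ht')
        (hint t ht') (hint (t + 1) ht) (hdrift (t + 1) (Nat.le_add_left 1 t) ht)
      have hcompl : P.real (A (t + 1))ᶜ
          ≤ P.real (A t)ᶜ + P.real (A t \ {ω | Φ (t + 1) ω ≤ M}) := by
        refine (measureReal_mono ?_).trans (measureReal_union_le _ _)
        rw [hA_succ]
        intro ω hω
        by_cases hωt : ω ∈ A t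
        · exact Or.inr ⟨hωt, fun hle => hω ⟨hωt, hle⟩⟩
        · exact Or.inl hωt
      have hcompl := mul_le_mul_of_nonneg_left hcompl hM.le
      rw [← hA_succ] at h
      push_cast
      linarith [ih ht']
  have hset : {ω | ∃ t ≤ T, M < Φ t ω} = (A T)ᶜ := by
    ext ω
    simp [hA]
  have hnn : 0 ≤ ∫ ω in A T, Φ T ω ∂P :=
    integral_nonneg fun ω => hnonneg T le_rfl ω
  rw [hset, ← ofReal_measureReal]
  refine ENNReal.ofReal_le_ofReal ((le_div_iff₀ hM).mpr ?_)
  linarith [key T le_rfl]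
end

section
/- There is a universal constant C > 0 such that the following holds. Let T be a full binary tree of depth h ≥ 1 with leaves ordered left to right, each leaf ℓ carrying a vector d_ℓ ∈ ℝ^n and a weight w_ℓ > 0; define node vectors d_u and node weights w_u as subtree sums, and for each internal node u with children u_l, u_r set q^l_u = w_{u_l}/w_u, q^r_u = w_{u_r}/w_u. Let ‖·‖ be any norm on ℝ^n and U ≥ 0, and assume q^l_u, q^r_u ∈ [1/20, 19/20] and ‖q^r_u·d_{u_l} − q^l_u·d_{u_r}‖ ≤ U for every internal node u. Suppose the leaves are partitioned into R color classes, each class consisting of consecutive leaves, and for each color c let d_c and w_c be the sums of d_ℓ and w_ℓ over leaves of color c, with w_c ≥ 1 for all c. Then for any two colors c ≠ c', ‖ (d_c/w_c − d_{c'}/w_{c'}) / (1/w_c + 1/w_{c'}) ‖ ≤ C·h·U. -/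
open Finset in
/-- If every dyadic block of an array of length `2 ^ h` has a sum of seminorm at most `B`, and the
whole array sums to zero, then every prefix sum has seminorm at most `h * B`. -/
theorem seminorm_prefix_sum_le_of_dyadic {V : Type*} [AddCommGroup V] [Module ℝ V]
    (f : Seminorm ℝ V) (h : ℕ) (e : ℕ → V) (B : ℝ) (hB : 0 ≤ B)
    (hnode : ∀ j ≤ h, ∀ k < 2 ^ j,
      f (∑ ℓ ∈ Ico (k * 2 ^ (h - j)) ((k + 1) * 2 ^ (h - j)), e ℓ) ≤ B)
    (hroot : ∑ ℓ ∈ range (2 ^ h), e ℓ = 0) (m : ℕ) (hm : m ≤ 2 ^ h) :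
    f (∑ ℓ ∈ range m, e ℓ) ≤ h * B := by
  rcases hm.eq_or_lt with rfl | hlt
  · rw [hroot, map_zero]
    positivity
  have key : ∀ j ≤ h, f (∑ ℓ ∈ range (m / 2 ^ (h - j) * 2 ^ (h - j)), e ℓ) ≤ j * B := by
    intro j
    induction j with
    | zero => intro _; simp [Nat.div_eq_of_lt hlt]
    | succ j ih =>
      intro hj
      have ih := ih (by omega)
      have hpow : 2 ^ (h - j) = 2 ^ (h - (j + 1)) * 2 := by
        rw [← pow_succ]; congr 1; omega
      have hdiv : m / 2 ^ (h - j) = m / 2 ^ (h - (j + 1)) / 2 := by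
        rw [hpow, Nat.div_div_eq_div_mul]
      rw [hdiv, hpow] at ih
      have hk : m / 2 ^ (h - (j + 1)) < 2 ^ (j + 1) := by
        rw [Nat.div_lt_iff_lt_mul (by positivity), ← pow_add]
        rwa [Nat.add_sub_cancel' hj]
      have hn := hnode (j + 1) hj
      generalize m / 2 ^ (h - (j + 1)) = k at *
      generalize 2 ^ (h - (j + 1)) = s at *
      push_cast
      rcases Nat.even_or_odd' k with ⟨i, rfl | rfl⟩
      · rw [show 2 * i / 2 * (s * 2) = 2 * i * s by
          rw [Nat.mul_div_cancel_left _ two_pos]; ring] at ih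
        linarith
      · rw [show (2 * i + 1) / 2 * (s * 2) = 2 * i * s by
          rw [show (2 * i + 1) / 2 = i by omega]; ring] at ih
        rw [← sum_range_add_sum_Ico e (Nat.mul_le_mul_right s (Nat.le_succ (2 * i)))]
        have := hn (2 * i) (by omega)
        linarith [map_add_le_add f (∑ ℓ ∈ range (2 * i * s), e ℓ)
          (∑ ℓ ∈ Ico (2 * i * s) ((2 * i + 1) * s), e ℓ)]
  simpa using key h le_rfl

/-- A node's deviation from the mean `μ` is at most `U` plus a `19/20` fraction of the deviation
of its parent. -/
theorem seminorm_child_deviation_le {V : Type*} [AddCommGroup V] [Module ℝ V]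
    (f : Seminorm ℝ V) (x y μ : V) (a b U : ℝ) (h0 : a + b ≠ 0)
    (ha : 0 ≤ a / (a + b)) (ha' : a / (a + b) ≤ 19 / 20)
    (hU : f ((b / (a + b)) • x - (a / (a + b)) • y) ≤ U)
    (hp : f ((x + y) - (a + b) • μ) ≤ 20 * U) :
    f (x - a • μ) ≤ 20 * U := by
  have hab : b / (a + b) = 1 - a / (a + b) := by field_simp; ring
  have hq : a = a / (a + b) * (a + b) := by field_simp
  have heq : x - a • μ = ((b / (a + b)) • x - (a / (a + b)) • y) +
      (a / (a + b)) • ((x + y) - (a + b) • μ) := by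
    rw [smul_sub, smul_smul, ← hq, hab]
    module
  have hmul : f ((a / (a + b)) • ((x + y) - (a + b) • μ)) ≤ 19 / 20 * (20 * U) := by
    rw [map_smul_eq_mul, Real.norm_of_nonneg ha]
    exact mul_le_mul ha' hp (apply_nonneg f _) (by norm_num)
  rw [heq]
  linarith [map_add_le_add f ((b / (a + b)) • x - (a / (a + b)) • y)
    ((a / (a + b)) • ((x + y) - (a + b) • μ))]

/-- If two weighted sums each deviate from the common mean `μ` by at most `B`, then so does their
normalized difference. -/
theorem seminorm_normalized_difference_le {V : Type*} [AddCommGroup V] [Module ℝ V]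
    (f : Seminorm ℝ V) (x y μ : V) (a b B : ℝ) (ha : 0 < a) (hb : 0 < b)
    (hx : f (x - a • μ) ≤ B) (hy : f (y - b • μ) ≤ B) :
    f ((a⁻¹ + b⁻¹)⁻¹ • (a⁻¹ • x - b⁻¹ • y)) ≤ B := by
  have heq : a⁻¹ • x - b⁻¹ • y = a⁻¹ • (x - a • μ) - b⁻¹ • (y - b • μ) := by
    rw [smul_sub, smul_sub, smul_smul, smul_smul, inv_mul_cancel₀ ha.ne', inv_mul_cancel₀ hb.ne']
    abel
  have hpos : 0 < a⁻¹ + b⁻¹ := by positivity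
  rw [heq, map_smul_eq_mul, Real.norm_of_nonneg (by positivity), inv_mul_le_iff₀ hpos]
  refine (map_sub_le_add f _ _).trans ?_
  rw [map_smul_eq_mul, map_smul_eq_mul, Real.norm_of_nonneg (by positivity),
    Real.norm_of_nonneg (by positivity), add_mul]
  gcongr

/-- A dyadic block sum is the sum over its two halves. -/
theorem sum_Ico_dyadic_split {V : Type*} [AddCommMonoid V] (g : ℕ → V) {h j : ℕ} (hj : j < h)
    (k : ℕ) :
    ∑ ℓ ∈ Finset.Ico (k * 2 ^ (h - j)) ((k + 1) * 2 ^ (h - j)), g ℓ =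
      ∑ ℓ ∈ Finset.Ico (2 * k * 2 ^ (h - (j + 1))) ((2 * k + 1) * 2 ^ (h - (j + 1))), g ℓ +
      ∑ ℓ ∈ Finset.Ico ((2 * k + 1) * 2 ^ (h - (j + 1)))
        ((2 * k + 1 + 1) * 2 ^ (h - (j + 1))), g ℓ := by
  have hpow : 2 ^ (h - j) = 2 * 2 ^ (h - (j + 1)) := by
    rw [← pow_succ']; congr 1; omega
  rw [Finset.sum_Ico_consecutive g (Nat.mul_le_mul_right _ (Nat.le_add_right _ 1))
    (Nat.mul_le_mul_right _ (Nat.le_add_right _ 1)), hpow]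
  congr 2 <;> ring


/-- **From node differences to multi-color discrepancy** (Lemma 7.2).  There is a universal
constant `C` such that in a full binary tree of depth `h` with leaf vectors `d_ℓ` and positive
weights `w_ℓ`, node sums `D j k`, `W j k`, child ratios in `[1/20, 19/20]`, and all weighted
node differences bounded by `U` in a norm `‖·‖`, if the leaves are partitioned into `R`
consecutive color classes with total weights `w_c ≥ 1`, then for any two colors `c ≠ c'`,
`‖(d_c/w_c − d_{c'}/w_{c'})/(1/w_c + 1/w_{c'})‖ ≤ C h U`. -/
theorem tree_multicolor_discrepancy :
    ∃ C : ℝ, 0 < C ∧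
      ∀ {n : ℕ} (h : ℕ), 1 ≤ h →
      ∀ (f : Seminorm ℝ (Fin n → ℝ)), (∀ x, f x = 0 → x = 0) →
      ∀ (dL : ℕ → (Fin n → ℝ)) (wL : ℕ → ℝ), (∀ ℓ < 2 ^ h, 0 < wL ℓ) →
      ∀ (D : ℕ → ℕ → (Fin n → ℝ)),
        (∀ j k, D j k = ∑ ℓ ∈ Finset.Ico (k * 2 ^ (h - j)) ((k + 1) * 2 ^ (h - j)), dL ℓ) →
      ∀ (W : ℕ → ℕ → ℝ),
        (∀ j k, W j k = ∑ ℓ ∈ Finset.Ico (k * 2 ^ (h - j)) ((k + 1) * 2 ^ (h - j)), wL ℓ) →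
      ∀ (U : ℝ), 0 ≤ U →
      (∀ j < h, ∀ k < 2 ^ j,
        (1 / 20 : ℝ) ≤ W (j + 1) (2 * k) / W j k ∧ W (j + 1) (2 * k) / W j k ≤ 19 / 20 ∧
        (1 / 20 : ℝ) ≤ W (j + 1) (2 * k + 1) / W j k ∧ W (j + 1) (2 * k + 1) / W j k ≤ 19 / 20) →
      (∀ j < h, ∀ k < 2 ^ j,
        f ((W (j + 1) (2 * k + 1) / W j k) • D (j + 1) (2 * k) -
           (W (j + 1) (2 * k) / W j k) • D (j + 1) (2 * k + 1)) ≤ U) →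
      -- the leaves are partitioned into `R` classes of consecutive leaves via boundaries `b`
      ∀ (R : ℕ) (b : ℕ → ℕ), Monotone b → b 0 = 0 → b R = 2 ^ h →
      -- each color class has total weight at least 1
      (∀ c < R, 1 ≤ ∑ ℓ ∈ Finset.Ico (b c) (b (c + 1)), wL ℓ) →
      ∀ c < R, ∀ c' < R, c ≠ c' →
        f (((∑ ℓ ∈ Finset.Ico (b c) (b (c + 1)), wL ℓ)⁻¹ +
              (∑ ℓ ∈ Finset.Ico (b c') (b (c' + 1)), wL ℓ)⁻¹)⁻¹ •
            ((∑ ℓ ∈ Finset.Ico (b c) (b (c + 1)), wL ℓ)⁻¹ •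
                (∑ ℓ ∈ Finset.Ico (b c) (b (c + 1)), dL ℓ) -
             (∑ ℓ ∈ Finset.Ico (b c') (b (c' + 1)), wL ℓ)⁻¹ •
                (∑ ℓ ∈ Finset.Ico (b c') (b (c' + 1)), dL ℓ)))
          ≤ C * h * U := by
  refine ⟨40, by norm_num, ?_⟩
  intro n h hh f _ dL wL _ D hD W hW U hU hq hdiff R b hb _ hbR hw c hc c' hc' _
  have hDs : ∀ j < h, ∀ k, D j k = D (j + 1) (2 * k) + D (j + 1) (2 * k + 1) := by
    intro j hj k
    rw [hD, hD, hD, sum_Ico_dyadic_split dL hj]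
  have hWs : ∀ j < h, ∀ k, W j k = W (j + 1) (2 * k) + W (j + 1) (2 * k + 1) := by
    intro j hj k
    rw [hW, hW, hW, sum_Ico_dyadic_split wL hj]
  have hW0 : ∀ j < h, ∀ k < 2 ^ j, W j k ≠ 0 := by
    intro j hj k hk h0
    have := (hq j hj k hk).1
    rw [h0, div_zero] at this
    norm_num at this
  set μ : Fin n → ℝ := (W 0 0)⁻¹ • D 0 0 with hμ
  have hroot : D 0 0 - W 0 0 • μ = 0 := by
    rw [hμ, smul_smul, mul_inv_cancel₀ (hW0 0 hh 0 (by simp)), one_smul, sub_self]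
  have hnode : ∀ j ≤ h, ∀ k < 2 ^ j, f (D j k - W j k • μ) ≤ 20 * U := by
    intro j
    induction j with
    | zero =>
      intro _ k hk
      obtain rfl : k = 0 := by simpa using hk
      rw [hroot, map_zero]
      positivity
    | succ j ih =>
      intro hj k hk
      obtain ⟨i, hi⟩ := Nat.even_or_odd' k
      have hi' : i < 2 ^ j := by rw [pow_succ] at hk; omega
      have hp := ih (by omega) i hi'
      have h0 := hW0 j hj i hi'
      obtain ⟨hl, hl', hr, hr'⟩ := hq j hj i hi'
      have hd := hdiff j hj i hi'
      rw [hWs j hj i] at hp h0 hl hl' hr hr' hd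
      rw [hDs j hj i] at hp
      rcases hi with rfl | rfl
      · exact seminorm_child_deviation_le f _ _ μ _ _ U h0 (by linarith) hl' hd hp
      · rw [add_comm (W _ _)] at h0 hr hr' hd hp
        rw [add_comm (D _ _)] at hp
        rw [map_sub_rev] at hd
        exact seminorm_child_deviation_le f _ _ μ _ _ U h0 (by linarith) hr' hd hp
  have hsum : ∀ s : Finset ℕ,
      ∑ ℓ ∈ s, (dL ℓ - wL ℓ • μ) = ∑ ℓ ∈ s, dL ℓ - (∑ ℓ ∈ s, wL ℓ) • μ := by
    intro s
    rw [Finset.sum_sub_distrib, Finset.sum_smul]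
  have hprefix := seminorm_prefix_sum_le_of_dyadic f h (fun ℓ => dL ℓ - wL ℓ • μ) (20 * U)
    (by positivity)
    (by
      intro j hj k hk
      rw [hsum, ← hD, ← hW]
      exact hnode j hj k hk)
    (by
      rw [hsum, ← hroot, hD, hW]
      simp)
  have hclass : ∀ i < R, f (∑ ℓ ∈ Finset.Ico (b i) (b (i + 1)), dL ℓ -
      (∑ ℓ ∈ Finset.Ico (b i) (b (i + 1)), wL ℓ) • μ) ≤ 40 * h * U := by
    intro i hi
    rw [← hsum, Finset.sum_Ico_eq_sub _ (hb (Nat.le_succ i))]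
    have h1 := hprefix (b (i + 1)) (hbR ▸ hb hi)
    have h2 := hprefix (b i) (hbR ▸ hb hi.le)
    refine (map_sub_le_add f _ _).trans ?_
    linarith
  exact seminorm_normalized_difference_le f _ _ μ _ _ _ (by linarith [hw c hc])
    (by linarith [hw c' hc']) (hclass c hc) (hclass c' hc')
end
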